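/- arXiv:1812.09200 — 3 statements merged into one kernel-verified Lean document; each statement's English description precedes it below -/
import Mathlib

section
/- (Theorem 1.5, part 2) Let m ∈ ℝ, γ > 0 and W ∈ C⁴(ℝ) with W''''(t) ≥ w² for all t ∈ ℝ, for some constant w > 0. Assume W''(m) + min_{k ∈ 2πℤ^N, k ≠ 0} ( |k|²/γ² + 1/|k|² ) ≥ 0 and Q_N ≥ (W'''(m))² / (3w²). Then m is a global minimizer of ℰ over H¹_m(𝕋^N), i.e., ℰ(φ) ≥ ℰ(m) for every φ ∈ H¹_m(𝕋^N). Moreover, if Q_N > (W'''(m))² / (3w²) strictly, then m is the unique global minimizer of ℰ over H¹_m(𝕋^N). -/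
open MeasureTheory Filter Real

noncomputable section

abbrev Pt (N : ℕ) := Fin N → ℝ

/-- partial derivative in direction `i` -/
def pd {N : ℕ} (i : Fin N) (f : Pt N → ℝ) (x : Pt N) : ℝ := fderiv ℝ f x (Pi.single i 1)

/-- second partial derivative ∂ᵢ∂ⱼ -/
def pd2 {N : ℕ} (i j : Fin N) (f : Pt N → ℝ) : Pt N → ℝ := pd i (pd j f)

/-- the unit cube [0,1]^N, fundamental domain of the torus 𝕋^N -/
def cube (N : ℕ) : Set (Pt N) := Set.Icc 0 1

/-- Laplacian on the torus -/
def lap {N : ℕ} (f : Pt N → ℝ) (x : Pt N) : ℝ := ∑ i, pd2 i i f x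

/-- |∇f|² -/
def gradSq {N : ℕ} (f : Pt N → ℝ) (x : Pt N) : ℝ := ∑ i, (pd i f x)^2

/-- 1-periodicity in each coordinate: a function on the torus 𝕋^N -/
def ZPeriodic {N : ℕ} (f : Pt N → ℝ) : Prop :=
  ∀ (x : Pt N) (i : Fin N), f (x + Pi.single i 1) = f x

/-- min_{k ∈ 2πℤ^N, k ≠ 0} (α - |k|²)² -/
def freqMinPFC (N : ℕ) (α : ℝ) : ℝ :=
  sInf {t : ℝ | ∃ k : Fin N → ℤ, k ≠ 0 ∧ t = (α - 4*π^2 * ∑ i, ((k i : ℝ))^2)^2}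

/-- admissible test functions in the definition of P_N -/
def AdmissibleP {N : ℕ} (u : Pt N → ℝ) : Prop :=
  ContDiff ℝ 2 u ∧ ZPeriodic u ∧
    (∫ x in cube N, (u x)^3) = 1 ∧ (∫ x in cube N, u x) = 0

/-- the product (∫ (αu+Δu)² + c u²) · (∫ u⁴) -/
def Penergy {N : ℕ} (α c : ℝ) (u : Pt N → ℝ) : ℝ :=
  (∫ x in cube N, ((α * u x + lap u x)^2 + c * (u x)^2)) * (∫ x in cube N, (u x)^4)

/-- the optimal constant P_N (with c = W''(m)) -/
def PN (N : ℕ) (α c : ℝ) : ℝ :=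
  sInf {p : ℝ | ∃ u : Pt N → ℝ, AdmissibleP u ∧ p = Penergy α c u}

/-- membership in H²_m(𝕋^N) -/
def MemH2m {N : ℕ} (m : ℝ) (φ : Pt N → ℝ) : Prop :=
  ContDiff ℝ 2 φ ∧ ZPeriodic φ ∧ (∫ x in cube N, φ x) = m

/-- the PFC functional 𝓕 on the torus -/
def Fen {N : ℕ} (α : ℝ) (W : ℝ → ℝ) (φ : Pt N → ℝ) : ℝ :=
  ∫ x in cube N, ((1/2) * (α * φ x + lap φ x)^2 + W (φ x))

/-- ψ = (-Δ)⁻¹ u : the unique zero-average (periodic) solution of -Δψ = u -/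
def IsPotential {N : ℕ} (u ψ : Pt N → ℝ) : Prop :=
  ContDiff ℝ 2 ψ ∧ ZPeriodic ψ ∧ (∫ x in cube N, ψ x) = 0 ∧ ∀ x : Pt N, -lap ψ x = u x

/-- min_{k ∈ 2πℤ^N, k ≠ 0} (|k|²/γ² + 1/|k|²) -/
def freqMinOK (N : ℕ) (γ : ℝ) : ℝ :=
  sInf {t : ℝ | ∃ k : Fin N → ℤ, k ≠ 0 ∧
    t = (4*π^2 * ∑ i, ((k i : ℝ))^2) / γ^2 + 1 / (4*π^2 * ∑ i, ((k i : ℝ))^2)}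

/-- admissible test functions in the definition of Q_N -/
def AdmissibleQ {N : ℕ} (u : Pt N → ℝ) : Prop :=
  ContDiff ℝ 1 u ∧ ZPeriodic u ∧
    (∫ x in cube N, (u x)^3) = 1 ∧ (∫ x in cube N, u x) = 0

/-- the product (∫ γ⁻²|∇u|² + |∇(-Δ)⁻¹u|² + c u²) · (∫ u⁴), where ψ = (-Δ)⁻¹u -/
def Qenergy {N : ℕ} (γ c : ℝ) (u ψ : Pt N → ℝ) : ℝ :=
  (∫ x in cube N, ((1/γ^2) * gradSq u x + gradSq ψ x + c * (u x)^2)) *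
    (∫ x in cube N, (u x)^4)

/-- the optimal constant Q_N (with c = W''(m)) -/
def QN (N : ℕ) (γ c : ℝ) : ℝ :=
  sInf {q : ℝ | ∃ u ψ : Pt N → ℝ, AdmissibleQ u ∧ IsPotential u ψ ∧ q = Qenergy γ c u ψ}

/-- membership in H¹_m(𝕋^N) -/
def MemH1m {N : ℕ} (m : ℝ) (φ : Pt N → ℝ) : Prop :=
  ContDiff ℝ 1 φ ∧ ZPeriodic φ ∧ (∫ x in cube N, φ x) = m

/-- the Ohta–Kawasaki energy, expressed through ψ = (-Δ)⁻¹(φ - m) -/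
def Een {N : ℕ} (γ : ℝ) (W : ℝ → ℝ) (φ ψ : Pt N → ℝ) : ℝ :=
  ∫ x in cube N, ((1/(2*γ^2)) * gradSq φ x + (1/2) * gradSq ψ x + W (φ x))

section OKFourier

local instance okMS : MeasureSpace UnitAddCircle := ⟨AddCircle.haarAddCircle⟩

local instance okHaar : Measure.IsAddHaarMeasure (volume : Measure UnitAddCircle) :=
  inferInstanceAs (Measure.IsAddHaarMeasure AddCircle.haarAddCircle)

local instance okProb : IsProbabilityMeasure (volume : Measure UnitAddCircle) :=
  inferInstanceAs (IsProbabilityMeasure AddCircle.haarAddCircle)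

/-- the character exp(-2πi k·x) -/
def okChar {N : ℕ} (k : Fin N → ℤ) (x : Pt N) : ℂ :=
  Complex.exp (-(2 * π * Complex.I * ∑ i, (k i : ℂ) * (x i : ℂ)))

/-- Fourier coefficient over the cube -/
def okCoeff {N : ℕ} (f : Pt N → ℝ) (k : Fin N → ℤ) : ℂ :=
  ∫ x in cube N, okChar k x * (f x : ℂ)

lemma ok_cube_set (N : ℕ) :
    {x : Pt N | ∀ i, x i ∈ Set.Ioc ((0 : Pt N) i) ((0 : Pt N) i + 1)} =ᵐ[volume] cube N := by
  have h := Measure.univ_pi_Ioc_ae_eq_Icc (μ := fun _ : Fin N => (volume : Measure ℝ))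
    (f := (0 : Pt N)) (g := (1 : Pt N))
  rw [← volume_pi] at h
  have e : {x : Pt N | ∀ i, x i ∈ Set.Ioc ((0 : Pt N) i) ((0 : Pt N) i + 1)}
      = Set.pi Set.univ fun i => Set.Ioc ((0 : Pt N) i) ((1 : Pt N) i) := by
    ext x; simp [Set.mem_pi]
  rw [e]; exact h

lemma ok_mFourier {N : ℕ} (k : Fin N → ℤ) (x : Pt N) :
    UnitAddTorus.mFourier (-k) (fun i => (x i : UnitAddCircle)) = okChar k x := by
  simp only [UnitAddTorus.mFourier, ContinuousMap.coe_mk, fourier_coe_apply, okChar]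
  rw [← Complex.exp_sum]
  congr 1
  rw [Finset.mul_sum, ← Finset.sum_neg_distrib]
  apply Finset.sum_congr rfl
  intro i _
  push_cast [Pi.neg_apply]
  ring

/-- section of the covering map -/
def okSec {N : ℕ} (t : UnitAddTorus (Fin N)) : Pt N := fun i => (AddCircle.equivIoc 1 0 (t i) : ℝ)

lemma okSec_measurable {N : ℕ} : Measurable (okSec (N := N)) := by
  refine measurable_pi_lambda _ fun i => ?_
  exact measurable_subtype_coe.comp
    ((AddCircle.measurableEquivIoc (1:ℝ) 0).measurable.comp (measurable_pi_apply i))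

lemma okSec_mem {N : ℕ} (t : UnitAddTorus (Fin N)) : okSec t ∈ cube N := by
  refine ⟨fun i => ?_, fun i => ?_⟩
  · exact (AddCircle.equivIoc (1:ℝ) 0 (t i)).2.1.le
  · have := (AddCircle.equivIoc (1:ℝ) 0 (t i)).2.2
    simpa [okSec] using this

lemma okSec_coe {N : ℕ} (x : Pt N)
    (hx : x ∈ {x : Pt N | ∀ i, x i ∈ Set.Ioc ((0 : Pt N) i) ((0 : Pt N) i + 1)}) :
    okSec (fun i => (x i : UnitAddCircle)) = x := by
  funext i
  exact AddCircle.equivIoc_coe_of_mem (by simpa using hx i)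

lemma ok_meas_set (N : ℕ) :
    MeasurableSet {x : Pt N | ∀ i, x i ∈ Set.Ioc ((0 : Pt N) i) ((0 : Pt N) i + 1)} :=
  MeasurableSet.univ_pi' (fun _ => measurableSet_Ioc)

lemma ok_compact (N : ℕ) : IsCompact (cube N) := isCompact_Icc

lemma ok_parseval {N : ℕ} (f : Pt N → ℝ) (hf : Continuous f) :
    HasSum (fun k => ‖okCoeff f k‖ ^ 2) (∫ x in cube N, (f x) ^ 2) := by
  let F : UnitAddTorus (Fin N) → ℂ := fun t => (f (okSec t) : ℂ)
  obtain ⟨C, hC⟩ := (ok_compact N).exists_bound_of_continuousOn hf.continuousOn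
  have hF : MemLp F 2 (volume : Measure (UnitAddTorus (Fin N))) := by
    refine MemLp.of_bound
      (Complex.measurable_ofReal.comp (hf.measurable.comp okSec_measurable)).aestronglyMeasurable
      C (ae_of_all _ fun t => ?_)
    simpa [F] using hC _ (okSec_mem t)
  have h := UnitAddTorus.hasSum_sq_mFourierCoeff (hF.toLp F)
  have e1 : ∀ k, UnitAddTorus.mFourierCoeff (hF.toLp F) k = okCoeff f k := by
    intro k
    have : UnitAddTorus.mFourierCoeff (hF.toLp F) k = UnitAddTorus.mFourierCoeff F k := by
      apply integral_congr_ae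
      filter_upwards [hF.coeFn_toLp] with t ht
      rw [ht]
    rw [this, UnitAddTorus.mFourierCoeff_eq_integral F k 0, okCoeff,
      ← setIntegral_congr_set (ok_cube_set N)]
    refine setIntegral_congr_fun (ok_meas_set N) fun x hx => ?_
    simp only [F, ok_mFourier, smul_eq_mul]
    rw [okSec_coe x hx]
  have e2 : (∫ t, ‖(hF.toLp F : UnitAddTorus (Fin N) → ℂ) t‖ ^ 2) = ∫ x in cube N, (f x) ^ 2 := by
    have : (∫ t, ‖(hF.toLp F : UnitAddTorus (Fin N) → ℂ) t‖ ^ 2) = ∫ t, ‖F t‖ ^ 2 := by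
      apply integral_congr_ae
      filter_upwards [hF.coeFn_toLp] with t ht
      rw [ht]
    rw [this, UnitAddTorus.integral_preimage (fun t => ‖F t‖ ^ 2) 0,
      ← setIntegral_congr_set (ok_cube_set N)]
    refine setIntegral_congr_fun (ok_meas_set N) fun x hx => ?_
    simp only [F]
    rw [okSec_coe x hx]
    simp
  rw [← e2]
  simpa only [e1] using h

end OKFourier

lemma ok_char_contDiff {N : ℕ} (k : Fin N → ℤ) : ContDiff ℝ 1 (okChar k) := by
  unfold okChar
  have : ContDiff ℝ 1 (fun x : Pt N => ∑ i, (k i : ℂ) * (x i : ℂ)) := by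
    refine ContDiff.sum fun i _ => contDiff_const.mul ?_
    exact Complex.ofRealCLM.contDiff.comp (contDiff_apply ℝ ℝ i)
  exact ((contDiff_const.mul this).neg).cexp

lemma ok_char_fderiv {N : ℕ} (k : Fin N → ℤ) (i : Fin N) (x : Pt N) :
    fderiv ℝ (okChar k) x (Pi.single i 1) = -(2 * π * Complex.I * k i) * okChar k x := by
  have hd : HasFDerivAt (okChar k) (fderiv ℝ (okChar k) x) x :=
    ((ok_char_contDiff k).differentiable one_ne_zero x).hasFDerivAt
  have hl := hd.hasLineDerivAt (Pi.single i 1)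
  have h2 : HasDerivAt (fun t : ℝ => okChar k (x + t • Pi.single i 1))
      (-(2 * π * Complex.I * k i) * okChar k x) 0 := by
    have e : (fun t : ℝ => okChar k (x + t • Pi.single i 1)) =
        fun t : ℝ => okChar k x * Complex.exp (-(2 * π * Complex.I * k i) * (t : ℂ)) := by
      funext t
      simp only [okChar]
      rw [← Complex.exp_add]
      congr 1
      have : ∑ j, (k j : ℂ) * (((x + t • (Pi.single i 1 : Pt N)) j : ℝ) : ℂ)
          = (∑ j, (k j : ℂ) * (x j : ℂ)) + k i * t := by
        simp only [Pi.add_apply, Pi.smul_apply, smul_eq_mul, Complex.ofReal_add, mul_add,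
          Finset.sum_add_distrib]
        congr 1
        rw [Finset.sum_eq_single i]
        · simp
        · intro b _ hb; simp [Pi.single_eq_of_ne hb]
        · simp
      rw [this]; ring
    rw [e]
    have h3 : HasDerivAt (fun t : ℝ => (-(2 * π * Complex.I * k i)) * (t : ℂ))
        ((-(2 * π * Complex.I * k i)) * 1) 0 := (Complex.ofRealCLM.hasDerivAt).const_mul _
    have h4 := (h3.cexp).const_mul (okChar k x)
    refine h4.congr_deriv ?_
    simp only [Complex.ofReal_zero, mul_zero, Complex.exp_zero]
    ring
  exact hl.unique h2

lemma ok_char_periodic {N : ℕ} (k : Fin N → ℤ) (i : Fin N) (x : Pt N) :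
    okChar k (x + Pi.single i 1) = okChar k x := by
  rw [← ok_mFourier, ← ok_mFourier]
  congr 1
  funext j
  by_cases h : j = i
  · subst h; simp
  · simp [Pi.single_eq_of_ne h]

/-- integral of a partial derivative of a periodic function vanishes -/
lemma ok_int_deriv {N : ℕ} (g : Pt N → ℂ) (hg : ContDiff ℝ 1 g) (i : Fin N)
    (hp : ∀ x, g (x + Pi.single i 1) = g x) :
    ∫ x in cube N, fderiv ℝ g x (Pi.single i 1) = 0 := by
  obtain _ | n := N
  · exact i.elim0
  have hc : Continuous fun x => fderiv ℝ g x (Pi.single i 1) :=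
    (hg.continuous_fderiv one_ne_zero).clm_apply continuous_const
  have h := integral_divergence_of_hasFDerivAt_off_countable' (0 : Pt (n+1)) (1 : Pt (n+1))
    (fun _ => zero_le_one)
    (fun j => if j = i then g else 0) (fun j x => if j = i then fderiv ℝ g x else 0) ∅
    Set.countable_empty
    (fun j => by
      by_cases hj : j = i
      · simpa [hj] using hg.continuous.continuousOn
      · simp only [hj, if_false]; exact continuousOn_const)
    (fun x _ j => by
      by_cases hj : j = i
      · simpa [hj] using (hg.differentiable one_ne_zero x).hasFDerivAt
      · simp only [hj, if_false]; exact hasFDerivAt_const (0:ℂ) x)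
    (by
      have : (fun x : Pt (n+1) => ∑ j, (if j = i then fderiv ℝ g x else 0) (Pi.single j 1))
          = fun x => fderiv ℝ g x (Pi.single i 1) := by
        funext x
        rw [Finset.sum_eq_single i]
        · simp
        · intro b _ hb; simp [hb]
        · simp
      rw [this]
      exact hc.continuousOn.integrableOn_compact isCompact_Icc)
  have e : ∀ x : Pt (n+1), ∑ j, (if j = i then fderiv ℝ g x else 0) (Pi.single j 1)
          = fderiv ℝ g x (Pi.single i 1) := by
    intro x
    rw [Finset.sum_eq_single i]
    · simp
    · intro b _ hb; simp [hb]
    · simp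
  simp only [e] at h
  rw [cube, h, Finset.sum_eq_single i]
  · simp only [if_true]
    rw [sub_eq_zero]
    congr 1
    funext x
    rw [← hp (Fin.insertNth i ((0 : Pt (n+1)) i) x)]
    congr 1
    funext j
    refine Fin.succAboveCases i ?_ (fun l => ?_) j
    · simp
    · simp
  · intro b _ hb; simp [hb]
  · simp

lemma ok_pd_cont {N : ℕ} (f : Pt N → ℝ) (hf : ContDiff ℝ 1 f) (i : Fin N) :
    Continuous (pd i f) :=
  (hf.continuous_fderiv one_ne_zero).clm_apply continuous_const

lemma ok_coeff_pd {N : ℕ} (f : Pt N → ℝ) (hf : ContDiff ℝ 1 f) (hp : ZPeriodic f) (i : Fin N)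
    (k : Fin N → ℤ) : okCoeff (pd i f) k = (2 * π * Complex.I * k i) * okCoeff f k := by
  have hfC : ContDiff ℝ 1 (fun x => (f x : ℂ)) := Complex.ofRealCLM.contDiff.comp hf
  have h := ok_int_deriv (fun x => okChar k x * (f x : ℂ)) ((ok_char_contDiff k).mul hfC) i
    (fun x => by simp only [ok_char_periodic, hp x i])
  have e : ∀ x, fderiv ℝ (fun x => okChar k x * (f x : ℂ)) x (Pi.single i 1) =
      okChar k x * (pd i f x : ℂ) - (2 * π * Complex.I * k i) * (okChar k x * (f x : ℂ)) := by
    intro x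
    have h1 := ((ok_char_contDiff k).differentiable one_ne_zero x).hasFDerivAt
    have h2 : HasFDerivAt (fun x => (f x : ℂ)) (Complex.ofRealCLM.comp (fderiv ℝ f x)) x :=
      Complex.ofRealCLM.hasFDerivAt.comp x (hf.differentiable one_ne_zero x).hasFDerivAt
    have h3 : HasFDerivAt (fun x => okChar k x * (f x : ℂ)) _ x := h1.mul h2
    rw [h3.fderiv]
    simp only [add_apply, smul_apply, ok_char_fderiv,
      smul_eq_mul, ContinuousLinearMap.comp_apply, Complex.ofRealCLM_apply, pd]
    ring
  simp only [e] at h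
  rw [integral_sub, integral_const_mul, sub_eq_zero] at h
  · exact h
  · exact (((ok_char_contDiff k).continuous.mul (Complex.continuous_ofReal.comp
      (ok_pd_cont f hf i))).continuousOn).integrableOn_compact (ok_compact N)
  · exact ((continuous_const.mul ((ok_char_contDiff k).continuous.mul
      hfC.continuous)).continuousOn).integrableOn_compact (ok_compact N)

/-- |2πk|² -/
def okL {N : ℕ} (k : Fin N → ℤ) : ℝ := 4 * π ^ 2 * ∑ i, ((k i : ℝ)) ^ 2

lemma ok_gradSq_cont {N : ℕ} (f : Pt N → ℝ) (hf : ContDiff ℝ 1 f) : Continuous (gradSq f) := by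
  unfold gradSq
  exact continuous_finsetSum _ fun i _ => (ok_pd_cont f hf i).pow 2

lemma ok_int {N : ℕ} {f : Pt N → ℝ} (hf : Continuous f) : IntegrableOn f (cube N) :=
  hf.continuousOn.integrableOn_compact (ok_compact N)

lemma ok_grad_hasSum {N : ℕ} (f : Pt N → ℝ) (hf : ContDiff ℝ 1 f) (hp : ZPeriodic f) :
    HasSum (fun k => okL k * ‖okCoeff f k‖ ^ 2) (∫ x in cube N, gradSq f x) := by
  have h := hasSum_sum (s := (Finset.univ : Finset (Fin N)))
    (fun i _ => ok_parseval (pd i f) (ok_pd_cont f hf i))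
  have e : (∫ x in cube N, gradSq f x) = ∑ i, ∫ x in cube N, (pd i f x) ^ 2 := by
    unfold gradSq
    rw [integral_finsetSum]
    intro i _
    exact ok_int ((ok_pd_cont f hf i).pow 2)
  rw [e]
  refine h.congr_fun fun k => ?_
  simp only [ok_coeff_pd f hf hp, norm_mul, mul_pow, okL]
  rw [Finset.mul_sum, Finset.sum_mul]
  refine Finset.sum_congr rfl fun i _ => ?_
  have : ‖(k i : ℂ)‖ ^ 2 = (k i : ℝ) ^ 2 := by
    rw [Complex.norm_intCast, sq_abs]
  have h2 : ‖(2 : ℂ)‖ ^ 2 * ‖(π : ℂ)‖ ^ 2 * ‖Complex.I‖ ^ 2 = 4 * π ^ 2 := by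
    simp; norm_num
  rw [this, h2]

lemma ok_pd_contDiff {N : ℕ} (f : Pt N → ℝ) (hf : ContDiff ℝ 2 f) (i : Fin N) :
    ContDiff ℝ 1 (pd i f) := by
  unfold pd
  exact (hf.fderiv_right (m := 1) (by norm_num)).clm_apply contDiff_const

lemma ok_pd_periodic {N : ℕ} (f : Pt N → ℝ) (hf : ZPeriodic f) (i : Fin N) :
    ZPeriodic (pd i f) := by
  intro x j
  unfold pd
  have : (fun y => f (y + Pi.single j 1)) = f := by funext y; exact hf y j
  rw [← fderiv_comp_add_right, this]

lemma ok_coeff_pot {N : ℕ} (u ψ : Pt N → ℝ) (h : IsPotential u ψ) (k : Fin N → ℤ) :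
    okCoeff u k = okL k * okCoeff ψ k := by
  obtain ⟨h1, h2, -, h4⟩ := h
  have h1' : ContDiff ℝ 1 ψ := h1.of_le (by norm_num)
  have e : ∀ i, okCoeff (pd2 i i ψ) k = (2 * π * Complex.I * k i) ^ 2 * okCoeff ψ k := by
    intro i
    unfold pd2
    rw [ok_coeff_pd _ (ok_pd_contDiff ψ h1 i) (ok_pd_periodic ψ h2 i), ok_coeff_pd _ h1' h2]
    ring
  have e2 : okCoeff u k = - ∑ i, okCoeff (pd2 i i ψ) k := by
    unfold okCoeff
    rw [← integral_finsetSum, ← integral_neg]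
    · congr 1
      funext x
      rw [← h4 x, lap]
      push_cast
      rw [← Finset.mul_sum]
      ring
    · intro i _
      exact (((ok_char_contDiff k).continuous.mul (Complex.continuous_ofReal.comp
        (ok_pd_cont _ (ok_pd_contDiff ψ h1 i) i))).continuousOn).integrableOn_compact
          (ok_compact N)
  rw [e2]
  simp only [e]
  rw [← Finset.sum_mul, okL]
  push_cast
  rw [Finset.mul_sum, ← neg_mul, ← Finset.sum_neg_distrib]
  congr 1
  refine Finset.sum_congr rfl fun i _ => ?_
  have := Complex.I_sq
  linear_combination (-4 * (π : ℂ) ^ 2 * (k i : ℂ) ^ 2) * this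

lemma okL_nonneg {N : ℕ} (k : Fin N → ℤ) : 0 ≤ okL k := by unfold okL; positivity

lemma okL_pos {N : ℕ} (k : Fin N → ℤ) (hk : k ≠ 0) : 0 < okL k := by
  obtain ⟨i, hi⟩ := Function.ne_iff.mp hk
  have : (0:ℝ) < ∑ i, ((k i : ℝ)) ^ 2 := by
    refine Finset.sum_pos' (fun _ _ => sq_nonneg _) ⟨i, Finset.mem_univ _, ?_⟩
    have : (k i : ℝ) ≠ 0 := by exact_mod_cast hi
    positivity
  unfold okL; positivity

lemma ok_quad {N : ℕ} (γ c : ℝ) (hst : 0 ≤ c + freqMinOK N γ)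
    (u ψ : Pt N → ℝ) (hu : ContDiff ℝ 1 u) (hp : ZPeriodic u) (hm : (∫ x in cube N, u x) = 0)
    (hψ : IsPotential u ψ) :
    0 ≤ ∫ x in cube N, ((1/γ^2) * gradSq u x + gradSq ψ x + c * (u x)^2) := by
  have hψ1 : ContDiff ℝ 1 ψ := hψ.1.of_le (by norm_num)
  have i1 := ok_int ((ok_gradSq_cont u hu).const_mul (1/γ^2))
  have i2 := ok_int (ok_gradSq_cont ψ hψ1)
  have i3 : IntegrableOn (fun x => c * (u x) ^ 2) (cube N) :=
    ok_int ((hu.continuous.pow 2).const_mul c)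
  have i12 : IntegrableOn (fun x => (1/γ^2) * gradSq u x + gradSq ψ x) (cube N) := i1.add i2
  rw [integral_add i12 i3, integral_add i1 i2, integral_const_mul, integral_const_mul]
  have hs := (((ok_grad_hasSum u hu hp).mul_left (1/γ^2)).add
    (ok_grad_hasSum ψ hψ1 hψ.2.1)).add ((ok_parseval u hu.continuous).mul_left c)
  refine hs.nonneg fun k => ?_
  have hc := ok_coeff_pot u ψ hψ k
  by_cases hk : k = 0
  · have h0 : okCoeff u k = 0 := by
      have : okCoeff u k = ((∫ x in cube N, u x : ℝ) : ℂ) := by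
        rw [← integral_complex_ofReal]
        simp [okCoeff, okChar, hk]
      rw [this, hm]; simp
    have hL : okL k = 0 := by simp [okL, hk]
    simp [h0, hL]
  · have hL := okL_pos k hk
    have hn : ‖okCoeff u k‖ = okL k * ‖okCoeff ψ k‖ := by
      rw [hc, norm_mul, Complex.norm_real, Real.norm_of_nonneg hL.le]
    have hle : freqMinOK N γ ≤ okL k / γ^2 + 1 / okL k := by
      refine csInf_le ⟨0, ?_⟩ ⟨k, hk, rfl⟩
      rintro t ⟨j, -, rfl⟩
      positivity
    have e : okL k * ‖okCoeff ψ k‖ ^ 2 = (1 / okL k) * ‖okCoeff u k‖ ^ 2 := by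
      rw [hn]; field_simp
    rw [e]
    have : 0 ≤ (okL k / γ^2 + 1 / okL k + c) * ‖okCoeff u k‖ ^ 2 :=
      mul_nonneg (by linarith) (sq_nonneg _)
    calc (0:ℝ) ≤ _ := this
      _ = _ := by ring

lemma ok_taylor (W : ℝ → ℝ) (m w : ℝ) (hW : ContDiff ℝ 4 W)
    (hW4 : ∀ t : ℝ, iteratedDeriv 4 W t ≥ w^2) (t : ℝ) :
    W m + deriv W m * t + iteratedDeriv 2 W m / 2 * t ^ 2 + iteratedDeriv 3 W m / 6 * t ^ 3
      + w ^ 2 / 24 * t ^ 4 ≤ W (m + t) := by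
  by_cases ht : t = 0
  · subst ht; simp
  have hne : m ≠ m + t := by simpa using ht
  obtain ⟨y, -, hy⟩ := taylor_mean_remainder_lagrange_iteratedDeriv (n := 3) hne
    (f := W) (by norm_num; exact hW.contDiffOn)
  have hu : UniqueDiffOn ℝ (Set.uIcc m (m + t)) := uniqueDiffOn_uIcc hne
  have e : ∀ j : ℕ, j ≤ 4 →
      iteratedDerivWithin j W (Set.uIcc m (m + t)) m = iteratedDeriv j W m := by
    intro j hj
    exact iteratedDerivWithin_eq_iteratedDeriv hu
      ((hW.of_le (by exact_mod_cast hj)).contDiffAt) Set.left_mem_uIcc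
  simp only [taylorWithinEval_succ, taylor_within_zero_eval] at hy
  rw [e _ (by norm_num), e _ (by norm_num), e _ (by norm_num)] at hy
  have h4 := hW4 y
  norm_num [Nat.factorial, iteratedDeriv_one] at hy
  have : w ^ 2 * t ^ 4 ≤ iteratedDeriv 4 W y * t ^ 4 :=
    mul_le_mul_of_nonneg_right h4 (by positivity)
  linarith

/-- periods of a function -/
def okPeriods {N : ℕ} (u : Pt N → ℝ) : AddSubgroup (Pt N) where
  carrier := {v | ∀ x, u (x + v) = u x}
  zero_mem' := fun x => by simp
  add_mem' := fun {a b} ha hb x => by rw [← add_assoc, hb, ha]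
  neg_mem' := fun {a} ha x => by rw [← ha (x + -a)]; simp

lemma ok_exists_cube {N : ℕ} (u : Pt N → ℝ) (hp : ZPeriodic u) (x : Pt N) :
    ∃ y ∈ cube N, u y = u x := by
  have hv : (∑ i, (-⌊x i⌋ : ℤ) • (Pi.single i 1 : Pt N)) ∈ okPeriods u := by
    refine sum_mem fun i _ => zsmul_mem ?_ _
    exact fun y => hp y i
  refine ⟨x + ∑ i, (-⌊x i⌋ : ℤ) • (Pi.single i 1 : Pt N), ?_, hv x⟩
  have e : x + ∑ i, (-⌊x i⌋ : ℤ) • (Pi.single i 1 : Pt N) = fun i => Int.fract (x i) := by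
    funext j
    rw [Pi.add_apply, Finset.sum_apply, Finset.sum_eq_single j]
    · simp [Int.fract, sub_eq_add_neg]
    · intro b _ hb; simp [Pi.single_eq_of_ne hb.symm]
    · simp
  rw [e]
  exact ⟨fun i => Int.fract_nonneg _, fun i => (Int.fract_lt_one _).le⟩

lemma ok_cube_closure (N : ℕ) : cube N ⊆ closure (interior (cube N)) := by
  have hc : Convex ℝ (cube N) := convex_Icc _ _
  have hne : (interior (cube N)).Nonempty := by
    refine ⟨fun _ => 1/2, ?_⟩
    have : (Set.pi Set.univ fun _ : Fin N => Set.Ioo (0:ℝ) 1) ⊆ cube N := fun x hx =>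
      ⟨fun i => (hx i trivial).1.le, fun i => (hx i trivial).2.le⟩
    refine interior_maximal this (isOpen_set_pi Set.finite_univ fun _ _ => isOpen_Ioo) ?_
    intro i _
    norm_num
  rw [hc.closure_interior_eq_closure_of_nonempty_interior hne]
  exact subset_closure

lemma ok_int_pos {N : ℕ} (u : Pt N → ℝ) (hu : Continuous u) (hp : ZPeriodic u) (hne : u ≠ 0) :
    0 < ∫ x in cube N, (u x) ^ 4 := by
  obtain ⟨x, hx⟩ := Function.ne_iff.mp hne
  obtain ⟨y, hy, hyx⟩ := ok_exists_cube u hp x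
  have hc : Continuous fun x => (u x) ^ 4 := hu.pow 4
  rw [setIntegral_pos_iff_support_of_nonneg_ae
    (ae_of_all _ fun x => by positivity) (ok_int hc)]
  have ho : IsOpen (Function.support fun x => (u x) ^ 4) := hc.isOpen_support
  have hys : y ∈ Function.support fun x => (u x) ^ 4 := by
    simp only [Function.mem_support]
    rw [hyx]
    exact pow_ne_zero 4 hx
  obtain ⟨z, hz⟩ := mem_closure_iff.mp (ok_cube_closure N hy) _ ho hys
  have h := (ho.inter isOpen_interior).measure_pos (volume : Measure (Pt N)) ⟨z, hz⟩
  exact h.trans_le (measure_mono (Set.inter_subset_inter_right _ interior_subset))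

lemma ok_pd_mul {N : ℕ} (a : ℝ) (f : Pt N → ℝ) (i : Fin N) :
    pd i (fun x => a * f x) = fun x => a * pd i f x := by
  funext x
  unfold pd
  have : (fun x => a * f x) = a • f := rfl
  rw [this, fderiv_const_smul_field]
  rfl

lemma ok_gradSq_mul {N : ℕ} (a : ℝ) (f : Pt N → ℝ) (x : Pt N) :
    gradSq (fun x => a * f x) x = a ^ 2 * gradSq f x := by
  unfold gradSq
  simp only [ok_pd_mul, Finset.mul_sum, mul_pow]

lemma ok_pot_mul {N : ℕ} (a : ℝ) (u ψ : Pt N → ℝ) (h : IsPotential u ψ) :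
    IsPotential (fun x => a * u x) (fun x => a * ψ x) := by
  obtain ⟨h1, h2, h3, h4⟩ := h
  refine ⟨contDiff_const.mul h1, fun x i => by simp only [h2 x i], ?_, fun x => ?_⟩
  · rw [integral_const_mul, h3, mul_zero]
  · change -lap (fun x => a * ψ x) x = a * u x
    rw [← h4 x]
    simp only [lap, pd2, ok_pd_mul, ← Finset.mul_sum]
    ring

lemma ok_QN {N : ℕ} (γ c : ℝ) (hst : 0 ≤ c + freqMinOK N γ)
    (u ψ : Pt N → ℝ) (hu : ContDiff ℝ 1 u) (hp : ZPeriodic u) (hm : (∫ x in cube N, u x) = 0)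
    (hψ : IsPotential u ψ) (hC : (∫ x in cube N, (u x) ^ 3) ≠ 0) :
    QN N γ c * (∫ x in cube N, (u x) ^ 3) ^ 2 ≤ Qenergy γ c u ψ := by
  set C := ∫ x in cube N, (u x) ^ 3 with hCdef
  obtain ⟨a, ha⟩ : ∃ a : ℝ, a ^ 3 = C := by
    rcases le_total 0 C with h | h
    · exact ⟨_, Real.rpow_inv_natCast_pow (n := 3) h (by norm_num)⟩
    · have h3 := Real.rpow_inv_natCast_pow (n := 3) (neg_nonneg.mpr h) (by norm_num)
      refine ⟨-((-C) ^ (((3 : ℕ) : ℝ)⁻¹)), ?_⟩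
      rw [Odd.neg_pow (by decide), h3, neg_neg]
  have ha0 : a ≠ 0 := by rintro rfl; exact hC (by rw [← ha]; norm_num)
  have hle : QN N γ c ≤ Qenergy γ c (fun x => a⁻¹ * u x) (fun x => a⁻¹ * ψ x) := by
    refine csInf_le ⟨0, ?_⟩ ⟨_, _, ⟨contDiff_const.mul hu, fun x i => by simp only [hp x i], ?_, ?_⟩,
      ok_pot_mul _ u ψ hψ, rfl⟩
    · rintro q ⟨v, χ, ⟨h1, h2, -, h4⟩, h5, rfl⟩
      refine mul_nonneg (ok_quad γ c hst v χ h1 h2 h4 h5) ?_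
      exact integral_nonneg fun x => by positivity
    · simp only [mul_pow]
      rw [integral_const_mul, ← hCdef, ← ha]
      field_simp
    · rw [integral_const_mul, hm, mul_zero]
  have e : Qenergy γ c (fun x => a⁻¹ * u x) (fun x => a⁻¹ * ψ x) * C ^ 2 = Qenergy γ c u ψ := by
    unfold Qenergy
    have e1 : ∀ x, (1/γ^2) * gradSq (fun x => a⁻¹ * u x) x + gradSq (fun x => a⁻¹ * ψ x) x
        + c * (a⁻¹ * u x) ^ 2 = (a⁻¹) ^ 2 *
        ((1/γ^2) * gradSq u x + gradSq ψ x + c * (u x) ^ 2) := by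
      intro x
      rw [ok_gradSq_mul, ok_gradSq_mul]; ring
    simp only [e1]
    simp only [mul_pow]
    rw [integral_const_mul, integral_const_mul, ← ha]
    field_simp
  rw [← e]
  exact mul_le_mul_of_nonneg_right hle (sq_nonneg _)

lemma ok_energy {N : ℕ} (m γ w : ℝ) (W : ℝ → ℝ) (hW : ContDiff ℝ 4 W)
    (hW4 : ∀ t : ℝ, iteratedDeriv 4 W t ≥ w^2) (φ ψ : Pt N → ℝ) (hφ : ContDiff ℝ 1 φ)
    (hψ : ContDiff ℝ 1 ψ) (hm : (∫ x in cube N, (φ x - m)) = 0) :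
    Een γ W (fun _ : Pt N => m) (fun _ : Pt N => 0) +
      ((1/2) * (∫ x in cube N, ((1/γ^2) * gradSq (fun x => φ x - m) x + gradSq ψ x
        + iteratedDeriv 2 W m * (φ x - m)^2))
      + iteratedDeriv 3 W m / 6 * (∫ x in cube N, (φ x - m)^3)
      + w ^ 2 / 24 * (∫ x in cube N, (φ x - m)^4)) ≤ Een γ W φ ψ := by
  have hg : ∀ x, gradSq (fun x => φ x - m) x = gradSq φ x := by
    intro x; simp [gradSq, pd, fderiv_sub_const]
  have h0 : Een γ W (fun _ : Pt N => m) (fun _ : Pt N => 0) = ∫ x in cube N, W m := by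
    simp [Een, gradSq, pd]
  rw [h0]
  simp only [hg]
  have cu : Continuous fun x => φ x - m := hφ.continuous.sub continuous_const
  have cg := ok_gradSq_cont φ hφ
  have cg' := ok_gradSq_cont ψ hψ
  have cW : Continuous fun x => W (φ x) := hW.continuous.comp hφ.continuous
  have i0 : IntegrableOn (fun _ : Pt N => W m) (cube N) := ok_int continuous_const
  have i1 : IntegrableOn (fun x => deriv W m * (φ x - m)) (cube N) := ok_int (by fun_prop)
  have i2 : IntegrableOn (fun x => (1/2) * ((1/γ^2) * gradSq φ x + gradSq ψ x
        + iteratedDeriv 2 W m * (φ x - m)^2)) (cube N) := ok_int (by fun_prop)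
  have i3 : IntegrableOn (fun x => iteratedDeriv 3 W m / 6 * (φ x - m)^3) (cube N) :=
    ok_int (by fun_prop)
  have i4 : IntegrableOn (fun x => w ^ 2 / 24 * (φ x - m)^4) (cube N) := ok_int (by fun_prop)
  have key : ∫ x in cube N, (W m + (deriv W m * (φ x - m) + ((1/2) * ((1/γ^2) * gradSq φ x
      + gradSq ψ x + iteratedDeriv 2 W m * (φ x - m)^2) + (iteratedDeriv 3 W m / 6 * (φ x - m)^3
      + w ^ 2 / 24 * (φ x - m)^4)))) ≤ Een γ W φ ψ := by
    refine setIntegral_mono (i0.add (i1.add (i2.add (i3.add i4)))) (ok_int (by fun_prop)) ?_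
    intro x
    have := ok_taylor W m w hW hW4 (φ x - m)
    rw [add_sub_cancel] at this
    have e : 1 / (2 * γ ^ 2) = (1/2) * (1/γ^2) := by ring
    simp only [e]
    linarith
  have j3 : IntegrableOn (fun x => iteratedDeriv 3 W m / 6 * (φ x - m)^3
      + w ^ 2 / 24 * (φ x - m)^4) (cube N) := i3.add i4
  have j2 : IntegrableOn (fun x => (1/2) * ((1/γ^2) * gradSq φ x
      + gradSq ψ x + iteratedDeriv 2 W m * (φ x - m)^2) + (iteratedDeriv 3 W m / 6 * (φ x - m)^3
      + w ^ 2 / 24 * (φ x - m)^4)) (cube N) := i2.add j3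
  have j1 : IntegrableOn (fun x => deriv W m * (φ x - m) + ((1/2) * ((1/γ^2) * gradSq φ x
      + gradSq ψ x + iteratedDeriv 2 W m * (φ x - m)^2) + (iteratedDeriv 3 W m / 6 * (φ x - m)^3
      + w ^ 2 / 24 * (φ x - m)^4))) (cube N) := i1.add j2
  rw [integral_add i0 j1, integral_add i1 j2,
    integral_add i2 j3, integral_add i3 i4, integral_const_mul, integral_const_mul,
    integral_const_mul, integral_const_mul, hm] at key
  linarith

lemma ok_mean {N : ℕ} (m : ℝ) (φ : Pt N → ℝ) (hφ : Continuous φ)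
    (hm : (∫ x in cube N, φ x) = m) : (∫ x in cube N, (φ x - m)) = 0 := by
  rw [integral_sub (ok_int hφ) (ok_int continuous_const), hm]
  simp [cube, Measure.real, Real.volume_Icc_pi]

lemma ok_alg (A C D K w : ℝ) (hA : 0 ≤ A) (hD : 0 ≤ D)
    (h : K ^ 2 / (3 * w ^ 2) * C ^ 2 ≤ A * D) (hw : 0 < w) :
    0 ≤ (1/2) * A + K / 6 * C + w ^ 2 / 24 * D := by
  have h1 : K ^ 2 * C ^ 2 ≤ 3 * w ^ 2 * (A * D) := by
    have : K ^ 2 / (3 * w ^ 2) * C ^ 2 = K ^ 2 * C ^ 2 / (3 * w ^ 2) := by ring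
    rw [this, div_le_iff₀ (by positivity)] at h
    linarith
  have h2 : |K / 6 * C| ≤ (1/2) * A + w ^ 2 / 24 * D := by
    apply abs_le_of_sq_le_sq _ (by positivity)
    nlinarith [sq_nonneg ((1/2) * A - w ^ 2 / 24 * D)]
  linarith [neg_abs_le (K / 6 * C)]

lemma ok_alg_strict (A C D K w : ℝ) (hA : 0 ≤ A) (hD : 0 ≤ D)
    (h : K ^ 2 / (3 * w ^ 2) * C ^ 2 < A * D) (hw : 0 < w) :
    0 < (1/2) * A + K / 6 * C + w ^ 2 / 24 * D := by
  have h1 : K ^ 2 * C ^ 2 < 3 * w ^ 2 * (A * D) := by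
    have : K ^ 2 / (3 * w ^ 2) * C ^ 2 = K ^ 2 * C ^ 2 / (3 * w ^ 2) := by ring
    rw [this, div_lt_iff₀ (by positivity)] at h
    linarith
  have h2 : |K / 6 * C| < (1/2) * A + w ^ 2 / 24 * D := by
    apply abs_lt_of_sq_lt_sq _ (by positivity)
    nlinarith [sq_nonneg ((1/2) * A - w ^ 2 / 24 * D)]
  linarith [neg_abs_le (K / 6 * C)]

/-- Theorem 1.5, part 2: global minimality (and uniqueness under strict inequality)
of the uniform state m for the Ohta–Kawasaki energy. -/
theorem OK_uniform_state_global_min (N : ℕ) (hN : 0 < N) (m γ w : ℝ) (hγ : 0 < γ)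
    (W : ℝ → ℝ) (hw : 0 < w) (hW : ContDiff ℝ 4 W)
    (hW4 : ∀ t : ℝ, iteratedDeriv 4 W t ≥ w^2)
    (hstab : 0 ≤ iteratedDeriv 2 W m + freqMinOK N γ)
    (hQ : QN N γ (iteratedDeriv 2 W m) ≥ (iteratedDeriv 3 W m)^2 / (3 * w^2)) :
    (∀ φ ψ : Pt N → ℝ, MemH1m m φ → IsPotential (fun x => φ x - m) ψ →
        Een γ W φ ψ ≥ Een γ W (fun _ : Pt N => m) (fun _ : Pt N => 0)) ∧
      (QN N γ (iteratedDeriv 2 W m) > (iteratedDeriv 3 W m)^2 / (3 * w^2) →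
        ∀ φ ψ : Pt N → ℝ, MemH1m m φ → IsPotential (fun x => φ x - m) ψ →
          φ ≠ (fun _ : Pt N => m) →
          Een γ W φ ψ > Een γ W (fun _ : Pt N => m) (fun _ : Pt N => 0)) := by
  have main : ∀ φ ψ : Pt N → ℝ, MemH1m m φ → IsPotential (fun x => φ x - m) ψ →
      ∃ A C D : ℝ, 0 ≤ A ∧ 0 ≤ D ∧ (φ ≠ (fun _ : Pt N => m) → 0 < D) ∧
        (C ≠ 0 → QN N γ (iteratedDeriv 2 W m) * C ^ 2 ≤ A * D) ∧
        Een γ W (fun _ : Pt N => m) (fun _ : Pt N => 0) +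
          ((1/2) * A + iteratedDeriv 3 W m / 6 * C + w ^ 2 / 24 * D) ≤ Een γ W φ ψ := by
    intro φ ψ ⟨h1, h2, h3⟩ hψ
    have hu : ContDiff ℝ 1 (fun x => φ x - m) := h1.sub contDiff_const
    have hp : ZPeriodic (fun x => φ x - m) := fun x i => by simp only [h2 x i]
    have hm := ok_mean m φ h1.continuous h3
    refine ⟨_, _, _, ok_quad γ _ hstab _ ψ hu hp hm hψ,
      integral_nonneg (f := fun x => (φ x - m) ^ 4) fun x => by positivity, ?_,
      fun hC => ok_QN γ _ hstab _ ψ hu hp hm hψ hC,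
      ok_energy m γ w W hW hW4 φ ψ h1 (hψ.1.of_le (by norm_num)) hm⟩
    intro hne
    refine ok_int_pos _ hu.continuous hp ?_
    intro h0
    apply hne
    funext x
    have := congrFun h0 x
    simp only [Pi.zero_apply] at this
    linarith
  refine ⟨fun φ ψ hφ hψ => ?_, fun hQ' φ ψ hφ hψ hne => ?_⟩
  · obtain ⟨A, C, D, hA, hD, -, hC, hE⟩ := main φ ψ hφ hψ
    have h := ok_alg A C D (iteratedDeriv 3 W m) w hA hD (by
      by_cases h0 : C = 0
      · rw [h0]; simpa using mul_nonneg hA hD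
      · exact (mul_le_mul_of_nonneg_right hQ (sq_nonneg C)).trans (hC h0)) hw
    linarith
  · obtain ⟨A, C, D, hA, hD, hD', hC, hE⟩ := main φ ψ hφ hψ
    have hDp := hD' hne
    have h : 0 < (1/2) * A + iteratedDeriv 3 W m / 6 * C + w ^ 2 / 24 * D := by
      by_cases h0 : C = 0
      · have : 0 < w ^ 2 / 24 * D := by positivity
        rw [h0]; linarith
      · refine ok_alg_strict A C D (iteratedDeriv 3 W m) w hA hD ?_ hw
        have hC2 : 0 < C ^ 2 := by positivity
        exact (mul_lt_mul_of_pos_right hQ' hC2).trans_le (hC h0)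
    linarith


end
end

section
/- (Identity (eqal11)) For every N ≥ 1, inf{ ( ∫_{𝕋^N} u² dx ) · ( ∫_{𝕋^N} u⁴ dx ) : u ∈ L⁴(𝕋^N), ∫_{𝕋^N} u³ dx = 1, ∫_{𝕋^N} u dx = 0 } = 1. (The lower bound ∫u² · ∫u⁴ ≥ (∫|u|³)² ≥ (∫u³)² = 1 follows from Hölder's inequality, and the value 1 is attained in the limit along the sequence built from v_n = n on (0,1/n) and v_n = −n/(n−1) on (1/n,1), normalized so that ∫ u_n³ = 1.) -/
open MeasureTheory Filter Real

noncomputable section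

def auxA (N : ℕ) (i : Fin N) (s : ℝ) : Set (Pt N) := {x | Int.fract (x i) ∈ Set.Ioo 0 s}

theorem auxA_meas (N : ℕ) (i : Fin N) (s : ℝ) : MeasurableSet (auxA N i s) :=
  (measurable_fract.comp (measurable_pi_apply i)) measurableSet_Ioo

theorem auxA_vol (N : ℕ) (i : Fin N) (s : ℝ) (h0 : 0 < s) (h1 : s < 1) :
    (volume.restrict (cube N)).real (auxA N i s) = s := by
  have h : auxA N i s ∩ cube N =
      Set.pi Set.univ (fun j => if j = i then Set.Ioo 0 s else Set.Icc (0:ℝ) 1) := by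
    ext x
    simp only [auxA, cube, Set.mem_inter_iff, Set.mem_ofPred_eq, Set.mem_Icc, Pi.le_def,
      Set.mem_pi, Set.mem_univ, true_imp_iff, Pi.zero_apply, Pi.one_apply]
    constructor
    · rintro ⟨hf, ha, hb⟩ j
      split_ifs with hj
      · subst hj
        rcases (hb j).lt_or_eq with h | h
        · rwa [Int.fract_eq_self.2 ⟨ha j, h⟩] at hf
        · rw [h] at hf; simp at hf
      · exact ⟨ha j, hb j⟩
    · intro hx
      have hi := hx i
      simp only [if_true, Set.mem_Ioo] at hi
      refine ⟨?_, fun j => ?_, fun j => ?_⟩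
      · rw [Int.fract_eq_self.2 ⟨hi.1.le, hi.2.trans h1⟩]; exact hi
      · have := hx j
        split_ifs at this with hj
        · exact this.1.le
        · exact this.1
      · have := hx j
        split_ifs at this with hj
        · exact (this.2.trans h1).le
        · exact this.2
  rw [measureReal_def, Measure.restrict_apply (auxA_meas N i s), h, volume_pi_pi,
    Finset.prod_eq_single i]
  · simp [h0.le]
  · intro j _ hj; simp [hj]
  · simp

theorem cube_prob (N : ℕ) : IsProbabilityMeasure (volume.restrict (cube N)) := by
  constructor
  simp [cube, Real.volume_Icc_pi]

theorem aux_int (N : ℕ) (i : Fin N) (s a b : ℝ) (h0 : 0 < s) (h1 : s < 1) (u : Pt N → ℝ)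
    (hu : ∀ x, (x ∈ auxA N i s → u x = a) ∧ (x ∉ auxA N i s → u x = b)) :
    IntegrableOn u (cube N) ∧ ∫ x in cube N, u x = s * a + (1 - s) * b := by
  have := cube_prob N
  have e : u = fun x => (auxA N i s).indicator (fun _ => a - b) x + b := by
    ext x
    by_cases hx : x ∈ auxA N i s
    · simp [hx, (hu x).1 hx]
    · simp [hx, (hu x).2 hx]
  have hi : Integrable ((auxA N i s).indicator (fun _ => a - b)) (volume.restrict (cube N)) :=
    (integrable_const _).indicator (auxA_meas N i s)
  rw [e]
  refine ⟨hi.add (integrable_const _), ?_⟩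
  rw [integral_add hi (integrable_const _), integral_indicator_const _ (auxA_meas N i s),
    auxA_vol N i s h0 h1]
  simp
  ring

theorem aux_mem (N : ℕ) (hN : 0 < N) (m : ℝ) (hm : 0 < m) :
    (m^2 + m + 1) / m^2 ∈ {p : ℝ | ∃ u : Pt N → ℝ, ZPeriodic u ∧
        IntegrableOn u (cube N) ∧
        IntegrableOn (fun x => (u x)^2) (cube N) ∧
        IntegrableOn (fun x => (u x)^3) (cube N) ∧
        IntegrableOn (fun x => (u x)^4) (cube N) ∧
        (∫ x in cube N, (u x)^3) = 1 ∧ (∫ x in cube N, u x) = 0 ∧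
        p = (∫ x in cube N, (u x)^2) * (∫ x in cube N, (u x)^4)} := by
  classical
  obtain ⟨c, hc⟩ : ∃ c : ℝ, c ^ 3 = 1 / ((m + 1) * m) := by
    refine ⟨(1 / ((m + 1) * m)) ^ ((3 : ℕ) : ℝ)⁻¹, ?_⟩
    exact Real.rpow_inv_natCast_pow (by positivity) (by norm_num)
  set i : Fin N := ⟨0, hN⟩
  set s : ℝ := 1 / (m + 2) with hs
  have h0 : 0 < s := by positivity
  have h1 : s < 1 := by rw [hs, div_lt_one (by positivity)]; linarith
  set u : Pt N → ℝ := fun x => if x ∈ auxA N i s then c * (m + 1) else -c with hu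
  have key : ∀ k : ℕ, _ := fun k =>
    aux_int N i s ((c * (m + 1)) ^ k) ((-c) ^ k) h0 h1 (fun x => u x ^ k)
      (fun x => ⟨fun h => by simp [hu, h], fun h => by simp [hu, h]⟩)
  have k1 := key 1
  simp only [pow_one] at k1
  refine ⟨u, ?_, k1.1, (key 2).1, (key 3).1, (key 4).1, ?_, ?_, ?_⟩
  · intro x j
    have : (x + Pi.single j 1 ∈ auxA N i s) ↔ x ∈ auxA N i s := by
      simp only [auxA, Set.mem_ofPred_eq, Pi.add_apply]
      by_cases hj : i = j
      · subst hj; simp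
      · simp [Pi.single_eq_of_ne hj]
    simp only [hu, this]
  · rw [(key 3).2]
    have : s * (c * (m + 1)) ^ 3 + (1 - s) * (-c) ^ 3 = c ^ 3 * ((m + 1) * m) := by
      rw [hs]; field_simp; ring
    rw [this, hc]; field_simp
  · rw [k1.2, hs]; field_simp; ring
  · rw [(key 2).2, (key 4).2]
    have : (s * (c * (m + 1)) ^ 2 + (1 - s) * (-c) ^ 2) *
        (s * (c * (m + 1)) ^ 4 + (1 - s) * (-c) ^ 4) =
        (c ^ 3) ^ 2 * ((m + 1) ^ 2 * (m ^ 2 + m + 1)) := by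
      rw [hs]; field_simp; ring
    rw [this, hc]; field_simp

/-- Identity (eqal11):
inf { ∫u² · ∫u⁴ : u ∈ L⁴(𝕋^N), ∫u³ = 1, ∫u = 0 } = 1. -/
theorem inf_L2_L4_product_eq_one (N : ℕ) (hN : 0 < N) :
    sInf {p : ℝ | ∃ u : Pt N → ℝ, ZPeriodic u ∧
        IntegrableOn u (cube N) ∧
        IntegrableOn (fun x => (u x)^2) (cube N) ∧
        IntegrableOn (fun x => (u x)^3) (cube N) ∧
        IntegrableOn (fun x => (u x)^4) (cube N) ∧
        (∫ x in cube N, (u x)^3) = 1 ∧ (∫ x in cube N, u x) = 0 ∧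
        p = (∫ x in cube N, (u x)^2) * (∫ x in cube N, (u x)^4)} = 1 := by
  apply le_antisymm
  · apply le_of_forall_pos_le_add
    intro ε hε
    set d : ℝ := min ε 1 / 2 with hd
    have hd0 : 0 < d := by positivity
    have hd1 : d ≤ ε / 2 := by
      have := min_le_left ε 1
      linarith
    have hd2 : d ≤ 1 := by
      have := min_le_right ε 1
      linarith
    refine (csInf_le ⟨0, ?_⟩ (aux_mem N hN (1 / d) (by positivity))).trans ?_
    · rintro p ⟨u, -, -, -, -, -, -, -, rfl⟩
      exact mul_nonneg (integral_nonneg fun x => by positivity)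
        (integral_nonneg fun x => by positivity)
    · have : ((1 / d) ^ 2 + 1 / d + 1) / (1 / d) ^ 2 = 1 + d + d ^ 2 := by field_simp
      rw [this]; nlinarith
  · apply le_csInf ⟨_, aux_mem N hN 1 one_pos⟩
    rintro p ⟨u, -, -, h2, h3, h4, e3, -, rfl⟩
    have key : ∀ t : ℝ, 0 ≤ (∫ x in cube N, (u x)^2) * (t * t) + (-2) * t
        + ∫ x in cube N, (u x)^4 := by
      intro t
      have h : 0 ≤ ∫ x in cube N, ((t * t) * u x ^ 2 + (-2 * t) * u x ^ 3 + u x ^ 4) :=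
        integral_nonneg fun x => by
          have : (t * t) * u x ^ 2 + (-2 * t) * u x ^ 3 + u x ^ 4 = (t * u x - u x ^ 2) ^ 2 := by
            ring
          simp only [Pi.zero_apply, this]; positivity
      have h23 : Integrable (fun x => (t * t) * u x ^ 2 + (-2 * t) * u x ^ 3)
          (volume.restrict (cube N)) := (h2.const_mul _).add (h3.const_mul _)
      rw [integral_add h23 h4,
        integral_add (h2.const_mul _) (h3.const_mul _), integral_const_mul,
        integral_const_mul, e3] at h
      linarith
    have := discrim_le_zero key
    rw [discrim] at this
    linarith

end
end

section
/- (PFC order–disorder transition, Remark 3.4 / Theorem 1.3.2 specialized) Let a > 0, m ∈ ℝ, α = 1, N = 2, and W(φ) = ¼(φ² − a)² (so that W'''' ≡ 6, W'''(m) = 6m, W''(m) = 3m² − a). If 3m² + (1 − 4π²)² ≥ a and P₂ ≥ 2m², then the uniform state m is a global minimizer of 𝓕(φ) = ∫_{𝕋²} ( ½(φ + Δφ)² + ¼(φ² − a)² ) dx over H²_m(𝕋²) = {φ ∈ H²(𝕋²) : ∫ φ dx = m}. -/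
open MeasureTheory Filter Real

noncomputable section

theorem aux_cs (f : ℝ → ℝ) (hf : Continuous f) :
    (∫ x in (0:ℝ)..1, f x)^2 ≤ ∫ x in (0:ℝ)..1, (f x)^2 := by
  set c := ∫ x in (0:ℝ)..1, f x with hc
  have h0 : 0 ≤ ∫ x in (0:ℝ)..1, (f x - c)^2 :=
    intervalIntegral.integral_nonneg (by norm_num) (fun x _ => sq_nonneg _)
  have h1 : ∫ x in (0:ℝ)..1, (f x - c)^2
      = (∫ x in (0:ℝ)..1, (f x)^2) - (∫ x in (0:ℝ)..1, 2 * c * f x) + ∫ x in (0:ℝ)..1, c^2 := by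
    rw [← intervalIntegral.integral_sub, ← intervalIntegral.integral_add]
    · congr 1; ext x; ring
    all_goals exact Continuous.intervalIntegrable (by fun_prop) _ _
  rw [intervalIntegral.integral_const_mul, ← hc] at h1
  simp at h1
  nlinarith

theorem aux_memLp (f : ℝ → ℂ) (hf : Continuous f) :
    MemLp f 2 (volume.restrict (Set.Ioc (0:ℝ) 1)) := by
  rw [memLp_two_iff_integrable_sq_norm hf.aestronglyMeasurable]
  have : Continuous (fun x => ‖f x‖^2) := by fun_prop
  exact (this.continuousOn.integrableOn_compact isCompact_Icc).mono_set Set.Ioc_subset_Icc_self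

theorem aux_swap (F : ℝ → ℝ → ℝ) (hF : Continuous (fun p : ℝ × ℝ => F p.1 p.2)) (a b c d : ℝ) :
    ∫ x in a..b, ∫ y in c..d, F x y = ∫ y in c..d, ∫ x in a..b, F x y := by
  apply MeasureTheory.intervalIntegral_intervalIntegral_swap
  apply IntegrableOn.mono_set (t := Set.uIcc a b ×ˢ Set.uIcc c d)
  · exact ContinuousOn.integrableOn_compact (isCompact_uIcc.prod isCompact_uIcc) hF.continuousOn
  · exact Set.prod_mono Set.uIoc_subset_uIcc Set.uIoc_subset_uIcc

theorem aux_wirtinger (f f' : ℝ → ℝ) (hd : ∀ x, HasDerivAt f (f' x) x) (hf' : Continuous f')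
    (hp : f 0 = f 1) :
    4 * π^2 * ((∫ x in (0:ℝ)..1, (f x)^2) - (∫ x in (0:ℝ)..1, f x)^2)
      ≤ ∫ x in (0:ℝ)..1, (f' x)^2 := by
  have hf : Continuous f := continuous_iff_continuousAt.2 fun x => (hd x).continuousAt
  have h01 : (0:ℝ) < 1 := one_pos
  have hF : Continuous (fun x => (f x : ℂ)) := by fun_prop
  have hF' : Continuous (fun x => (f' x : ℂ)) := by fun_prop
  have S1 := hasSum_sq_fourierCoeffOn h01 (aux_memLp _ hF)
  have S2 := hasSum_sq_fourierCoeffOn h01 (aux_memLp _ hF')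
  simp only [Complex.norm_real, norm_eq_abs, sq_abs, sub_zero, inv_one, one_smul] at S1 S2
  have S3 := (S1.mul_left (4 * π^2)).sub
    (hasSum_ite_eq (0:ℤ) (4 * π^2 * (∫ x in (0:ℝ)..1, f x)^2))
  rw [mul_sub]
  refine hasSum_le (fun n => ?_) S3 S2
  by_cases hn : n = 0
  · subst hn
    have h0 : fourierCoeffOn h01 (fun x => (f x : ℂ)) 0 = ((∫ x in (0:ℝ)..1, f x : ℝ) : ℂ) := by
      rw [fourierCoeffOn_eq_integral]
      simp [intervalIntegral.integral_ofReal]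
    rw [h0]
    simp only [Complex.norm_real, norm_eq_abs, sq_abs, if_true, sub_self]
    positivity
  · have h := fourierCoeffOn_of_hasDerivAt h01 hn (f := fun x => (f x : ℂ))
      (f' := fun x => (f' x : ℂ)) (fun x _ => (hd x).ofReal_comp)
      (hF'.intervalIntegrable _ _)
    rw [h, hp]
    simp only [hn, if_false, sub_self, mul_zero, zero_sub, Complex.ofReal_one, Complex.ofReal_zero,
      sub_zero, one_mul, norm_mul, norm_neg, norm_div, norm_one, Complex.norm_real, Complex.norm_I,
      mul_one, mul_pow]
    have hn1 : (1:ℝ) ≤ ‖(n:ℂ)‖^2 := by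
      rw [Complex.norm_intCast, sq_abs]
      have : 1 ≤ n^2 := by have := sq_pos_of_ne_zero hn; omega
      exact_mod_cast this
    have h2 : ‖(2:ℂ)‖ = 2 := by simp
    rw [h2, norm_eq_abs, div_pow, mul_pow, mul_pow, sq_abs]
    have hpi : 0 < π^2 := by positivity
    rw [one_pow, ← mul_assoc]
    have : 4 * π^2 * (1 / (2^2 * π^2 * ‖(n:ℂ)‖^2)) ≤ 1 := by
      rw [mul_one_div, div_le_one (by positivity)]
      nlinarith
    exact mul_le_of_le_one_left (by positivity) this

theorem aux_poincare (U Ux Uy : ℝ → ℝ → ℝ)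
    (hU : Continuous (Function.uncurry U)) (hUx : Continuous (Function.uncurry Ux))
    (hUy : Continuous (Function.uncurry Uy))
    (dx : ∀ x y, HasDerivAt (fun t => U t y) (Ux x y) x)
    (dy : ∀ x y, HasDerivAt (fun t => U x t) (Uy x y) y)
    (px : ∀ y, U 0 y = U 1 y) (py : ∀ x, U x 0 = U x 1)
    (h0 : ∫ y in (0:ℝ)..1, ∫ x in (0:ℝ)..1, U x y = 0) :
    4 * π^2 * (∫ y in (0:ℝ)..1, ∫ x in (0:ℝ)..1, (U x y)^2)
      ≤ (∫ y in (0:ℝ)..1, ∫ x in (0:ℝ)..1, (Ux x y)^2)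
        + ∫ y in (0:ℝ)..1, ∫ x in (0:ℝ)..1, (Uy x y)^2 := by
  have cU : Continuous (fun p : ℝ × ℝ => U p.1 p.2) := hU
  have cUx : Continuous (fun p : ℝ × ℝ => Ux p.1 p.2) := hUx
  have cUy : Continuous (fun p : ℝ × ℝ => Uy p.1 p.2) := hUy
  have par : ∀ F : ℝ → ℝ → ℝ, Continuous (fun p : ℝ × ℝ => F p.1 p.2) →
      Continuous (fun y => ∫ x in (0:ℝ)..1, F x y) := by
    intro F hF
    apply intervalIntegral.continuous_parametric_intervalIntegral_of_continuous'
    exact hF.comp continuous_swap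
  set g : ℝ → ℝ := fun y => ∫ x in (0:ℝ)..1, U x y with hg
  set g' : ℝ → ℝ := fun y => ∫ x in (0:ℝ)..1, Uy x y with hg'
  have cg : Continuous g := par _ cU
  have cg' : Continuous g' := par _ cUy
  have c1 := par (fun x y => (U x y)^2) (by fun_prop)
  have c2 := par (fun x y => (Ux x y)^2) (by fun_prop)
  have c3 := par (fun x y => (Uy x y)^2) (by fun_prop)
  -- derivative of g
  have gd : ∀ y, HasDerivAt g (g' y) y := by
    have key : ∀ y, g y = g 0 + ∫ t in (0:ℝ)..y, g' t := by
      intro y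
      have e1 : ∫ t in (0:ℝ)..y, g' t = ∫ x in (0:ℝ)..1, ∫ t in (0:ℝ)..y, Uy x t := by
        exact aux_swap (fun t x => Uy x t) (by fun_prop) _ _ _ _
      have e2 : ∀ x, ∫ t in (0:ℝ)..y, Uy x t = U x y - U x 0 := fun x =>
        intervalIntegral.integral_eq_sub_of_hasDerivAt (fun t _ => dy x t)
          (Continuous.intervalIntegrable (by fun_prop) _ _)
      rw [e1]
      simp only [e2]
      rw [intervalIntegral.integral_sub]
      · simp [hg]
      all_goals exact Continuous.intervalIntegrable (by fun_prop) _ _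
    intro y
    have : g = fun y => g 0 + ∫ t in (0:ℝ)..y, g' t := funext key
    rw [this]
    exact (intervalIntegral.integral_hasDerivAt_right (cg'.intervalIntegrable _ _)
      (cg'.stronglyMeasurableAtFilter _ _) cg'.continuousAt).const_add _
  have W1 := aux_wirtinger g g' gd cg' (by simp only [hg, py])
  rw [h0] at W1
  have W2 : ∫ y in (0:ℝ)..1, 4 * π^2 * ((∫ x in (0:ℝ)..1, (U x y)^2) - (g y)^2)
      ≤ ∫ y in (0:ℝ)..1, ∫ x in (0:ℝ)..1, (Ux x y)^2 := by
    apply intervalIntegral.integral_mono_on (by norm_num)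
    · exact Continuous.intervalIntegrable (by fun_prop) _ _
    · exact c2.intervalIntegrable _ _
    · intro y _
      exact aux_wirtinger (fun x => U x y) (fun x => Ux x y) (fun x => dx x y)
        (by fun_prop) (px y)
  have W3 : ∫ y in (0:ℝ)..1, (g' y)^2 ≤ ∫ y in (0:ℝ)..1, ∫ x in (0:ℝ)..1, (Uy x y)^2 := by
    apply intervalIntegral.integral_mono_on (by norm_num)
    · exact Continuous.intervalIntegrable (by fun_prop) _ _
    · exact c3.intervalIntegrable _ _
    · intro y _
      exact aux_cs (fun x => Uy x y) (by fun_prop)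
  rw [intervalIntegral.integral_const_mul, intervalIntegral.integral_sub
    (c1.intervalIntegrable _ _) (Continuous.intervalIntegrable (by fun_prop) _ _)] at W2
  nlinarith

theorem aux_cube (F : Pt 2 → ℝ) (hF : Continuous F) :
    ∫ x in cube 2, F x = ∫ y in (0:ℝ)..1, ∫ x in (0:ℝ)..1, F ![x, y] := by
  have h := ((volume_preserving_finTwoArrow ℝ).symm _).setIntegral_preimage_emb
    (MeasurableEquiv.measurableEmbedding _) F (cube 2)
  rw [← h]
  have hs : (MeasurableEquiv.finTwoArrow (α := ℝ)).symm ⁻¹' (cube 2)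
      = Set.Icc (0:ℝ) 1 ×ˢ Set.Icc (0:ℝ) 1 := by
    ext p
    simp [cube, Set.mem_Icc, Pi.le_def, Fin.forall_fin_two, MeasurableEquiv.finTwoArrow, Prod.le_def]
  rw [hs, Measure.volume_eq_prod, ← setIntegral_prod_swap, setIntegral_prod]
  · simp only [intervalIntegral.integral_of_le zero_le_one, integral_Icc_eq_integral_Ioc]
    rfl
  · apply ContinuousOn.integrableOn_compact (isCompact_Icc.prod isCompact_Icc)
    apply Continuous.continuousOn
    apply hF.comp
    apply continuous_pi
    intro i
    fin_cases i
    · exact continuous_snd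
    · exact continuous_fst

theorem aux_line0 (v : Pt 2 → ℝ) (hv : ContDiff ℝ 1 v) (x y : ℝ) :
    HasDerivAt (fun t => v ![t, y]) (pd 0 v ![x, y]) x := by
  have h1 : HasDerivAt (fun t : ℝ => (![t, y] : Pt 2)) (Pi.single 0 1) x := by
    rw [hasDerivAt_pi]
    intro i
    fin_cases i
    · simpa using hasDerivAt_id' x
    · simpa using hasDerivAt_const x y
  exact ((hv.differentiable one_ne_zero).differentiableAt.hasFDerivAt).comp_hasDerivAt x h1

theorem aux_line1 (v : Pt 2 → ℝ) (hv : ContDiff ℝ 1 v) (x y : ℝ) :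
    HasDerivAt (fun t => v ![x, t]) (pd 1 v ![x, y]) y := by
  have h1 : HasDerivAt (fun t : ℝ => (![x, t] : Pt 2)) (Pi.single 1 1) y := by
    rw [hasDerivAt_pi]
    intro i
    fin_cases i
    · simpa using hasDerivAt_const y x
    · simpa using hasDerivAt_id' y
  exact ((hv.differentiable one_ne_zero).differentiableAt.hasFDerivAt).comp_hasDerivAt y h1

theorem aux_per0 (v : Pt 2 → ℝ) (hv : ZPeriodic v) (y : ℝ) : v ![0, y] = v ![1, y] := by
  rw [← hv ![0, y] 0]
  congr 1
  ext i; fin_cases i <;> simp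

theorem aux_per1 (v : Pt 2 → ℝ) (hv : ZPeriodic v) (x : ℝ) : v ![x, 0] = v ![x, 1] := by
  rw [← hv ![x, 0] 1]
  congr 1
  ext i; fin_cases i <;> simp

theorem aux_pd_contDiff {n : ℕ} (i : Fin 2) (v : Pt 2 → ℝ) (hv : ContDiff ℝ (n + 1) v) :
    ContDiff ℝ n (pd i v) := by
  unfold pd
  exact (hv.fderiv_right le_rfl).clm_apply contDiff_const

theorem aux_pd_per (i : Fin 2) (v : Pt 2 → ℝ) (hv : ZPeriodic v) : ZPeriodic (pd i v) := by
  intro x j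
  unfold pd
  rw [← fderiv_comp_add_right]
  congr 2
  ext z
  exact hv z j

theorem aux_pt_cont : Continuous (fun p : ℝ × ℝ => (![p.1, p.2] : Pt 2)) := by
  apply continuous_pi
  intro i
  fin_cases i
  · exact continuous_fst
  · exact continuous_snd

theorem aux_int_pd (i : Fin 2) (v : Pt 2 → ℝ) (hv : ContDiff ℝ 1 v) (hp : ZPeriodic v) :
    ∫ x in cube 2, pd i v x = 0 := by
  have hc : ∀ i, Continuous (pd i v) := fun i =>
    (aux_pd_contDiff (n := 0) i v (by simpa using hv)).continuous
  have hc2 : ∀ i, Continuous (fun p : ℝ × ℝ => pd i v ![p.1, p.2]) := fun i =>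
    (hc i).comp aux_pt_cont
  have h0 := hc2 0
  have h1 := hc2 1
  rw [aux_cube _ (hc i)]
  fin_cases i
  · have : ∀ y, ∫ x in (0:ℝ)..1, pd 0 v ![x, y] = 0 := by
      intro y
      rw [intervalIntegral.integral_eq_sub_of_hasDerivAt (fun t _ => aux_line0 v hv t y)
        (Continuous.intervalIntegrable (h0.comp (Continuous.prodMk_left y)) _ _),
        aux_per0 v hp, sub_self]
    simp [this]
  · have : ∀ x, ∫ y in (0:ℝ)..1, pd 1 v ![x, y] = 0 := by
      intro x
      rw [intervalIntegral.integral_eq_sub_of_hasDerivAt (fun t _ => aux_line1 v hv x t)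
        (Continuous.intervalIntegrable (h1.comp (Continuous.prodMk_right x)) _ _),
        aux_per1 v hp, sub_self]
    have hs := aux_swap (fun y x => pd 1 v ![x, y]) (h1.comp continuous_swap) 0 1 0 1
    simp only [this, intervalIntegral.integral_zero] at hs
    exact hs

theorem aux_integrable (F : Pt 2 → ℝ) (hF : Continuous F) : IntegrableOn F (cube 2) :=
  hF.continuousOn.integrableOn_compact isCompact_Icc

theorem aux_lap_cont (u : Pt 2 → ℝ) (hu : ContDiff ℝ 2 u) : Continuous (lap u) := by
  unfold lap pd2
  refine continuous_finsetSum _ fun i _ => ?_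
  exact (aux_pd_contDiff (n := 0) i _
    (by simpa using aux_pd_contDiff (n := 1) i u (by simpa [one_add_one_eq_two] using hu))).continuous

theorem aux_pd1 (u : Pt 2 → ℝ) (hu : ContDiff ℝ 2 u) (i : Fin 2) : ContDiff ℝ 1 (pd i u) := by
  simpa using aux_pd_contDiff (n := 1) i u (by simpa [one_add_one_eq_two] using hu)

theorem aux_pd2c (u : Pt 2 → ℝ) (hu : ContDiff ℝ 2 u) (i : Fin 2) : Continuous (pd2 i i u) :=
  (aux_pd_contDiff (n := 0) i _ (by simpa using aux_pd1 u hu i)).continuous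

theorem aux_int_lap (u : Pt 2 → ℝ) (hu : ContDiff ℝ 2 u) (hp : ZPeriodic u) :
    ∫ x in cube 2, lap u x = 0 := by
  simp only [lap, Fin.sum_univ_two]
  rw [integral_add (aux_integrable _ (aux_pd2c u hu 0)) (aux_integrable _ (aux_pd2c u hu 1))]
  simp only [pd2]
  rw [aux_int_pd 0 _ (aux_pd1 u hu 0) (aux_pd_per _ _ hp),
    aux_int_pd 1 _ (aux_pd1 u hu 1) (aux_pd_per _ _ hp), add_zero]

theorem aux_parts (u : Pt 2 → ℝ) (hu : ContDiff ℝ 2 u) (hp : ZPeriodic u) (i : Fin 2) :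
    ∫ x in cube 2, u x * pd2 i i u x = - ∫ x in cube 2, (pd i u x)^2 := by
  have hu1 : ContDiff ℝ 1 u := hu.of_le one_le_two
  have h := aux_int_pd i (fun x => u x * pd i u x) (hu1.mul (aux_pd1 u hu i))
    (fun x j => by beta_reduce; rw [hp x j, aux_pd_per i u hp x j])
  have e : ∀ x, pd i (fun x => u x * pd i u x) x = u x * pd2 i i u x + (pd i u x)^2 := by
    intro x
    unfold pd2
    change fderiv ℝ (fun x => u x * pd i u x) x (Pi.single i 1) = _
    rw [fderiv_fun_mul (hu1.differentiable one_ne_zero).differentiableAt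
      ((aux_pd1 u hu i).differentiable one_ne_zero).differentiableAt]
    simp [pd]
    ring
  simp only [e] at h
  have c1 := hu.continuous
  have c2 := aux_pd2c u hu i
  have c3 := (aux_pd1 u hu i).continuous
  rw [integral_add (aux_integrable _ (by fun_prop)) (aux_integrable _ (by fun_prop))] at h
  linarith

theorem aux_poinc (u : Pt 2 → ℝ) (hu : ContDiff ℝ 2 u) (hp : ZPeriodic u)
    (h0 : ∫ x in cube 2, u x = 0) :
    4 * π^2 * (∫ x in cube 2, (u x)^2) ≤ - ∫ x in cube 2, u x * lap u x := by
  have hu1 : ContDiff ℝ 1 u := hu.of_le one_le_two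
  have c1 := hu.continuous
  have c2 := fun i => aux_pd2c u hu i
  have c3 := fun i => (aux_pd1 u hu i).continuous
  have e : - ∫ x in cube 2, u x * lap u x
      = (∫ x in cube 2, (pd 0 u x)^2) + ∫ x in cube 2, (pd 1 u x)^2 := by
    simp only [lap, Fin.sum_univ_two, mul_add]
    rw [integral_add (aux_integrable (fun x => u x * pd2 0 0 u x) (c1.mul (c2 0)))
      (aux_integrable (fun x => u x * pd2 1 1 u x) (c1.mul (c2 1))),
      aux_parts u hu hp, aux_parts u hu hp]
    ring
  rw [e, aux_cube (fun x => (u x)^2) (c1.pow 2), aux_cube (fun x => (pd 0 u x)^2) ((c3 0).pow 2),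
    aux_cube (fun x => (pd 1 u x)^2) ((c3 1).pow 2)]
  rw [aux_cube _ c1] at h0
  exact aux_poincare (fun x y => u ![x, y]) (fun x y => pd 0 u ![x, y]) (fun x y => pd 1 u ![x, y])
    (c1.comp aux_pt_cont) ((c3 0).comp aux_pt_cont) ((c3 1).comp aux_pt_cont)
    (aux_line0 u hu1) (aux_line1 u hu1) (aux_per0 u hp) (aux_per1 u hp) h0

/-- spectral gap -/
theorem aux_gap (u : Pt 2 → ℝ) (hu : ContDiff ℝ 2 u) (hp : ZPeriodic u)
    (h0 : ∫ x in cube 2, u x = 0) :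
    (1 - 4 * π^2)^2 * (∫ x in cube 2, (u x)^2) ≤ ∫ x in cube 2, (1 * u x + lap u x)^2 := by
  have c1 := hu.continuous
  have c2 := aux_lap_cont u hu
  have P := aux_poinc u hu hp h0
  set k : ℝ := 4 * π^2 - 1 with hk
  have hk0 : 0 ≤ k := by
    have := Real.pi_gt_three
    nlinarith
  have hn : 0 ≤ ∫ x in cube 2, (1 * u x + lap u x + k * u x)^2 :=
    integral_nonneg fun x => sq_nonneg _
  have e : ∫ x in cube 2, (1 * u x + lap u x + k * u x)^2
      = (∫ x in cube 2, (1 * u x + lap u x)^2) + (2 * k) * (∫ x in cube 2, u x * lap u x)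
        + (2 * k + k^2) * (∫ x in cube 2, (u x)^2) := by
    rw [← integral_const_mul, ← integral_const_mul, ← integral_add, ← integral_add]
    · congr 1; ext x; ring
    all_goals exact aux_integrable _ (by fun_prop)
  rw [e] at hn
  have : (1 - 4 * π^2)^2 = k^2 := by rw [hk]; ring
  rw [this]
  nlinarith [mul_le_mul_of_nonneg_left P hk0]

theorem aux_Q (a m : ℝ) (h1 : 3*m^2 + (1 - 4*π^2)^2 ≥ a) (u : Pt 2 → ℝ) (hu : ContDiff ℝ 2 u)
    (hp : ZPeriodic u) (h0 : ∫ x in cube 2, u x = 0) :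
    0 ≤ ∫ x in cube 2, ((1 * u x + lap u x)^2 + (3*m^2 - a) * (u x)^2) := by
  have c1 := hu.continuous
  have c2 := aux_lap_cont u hu
  have G := aux_gap u hu hp h0
  have hn : 0 ≤ ∫ x in cube 2, (u x)^2 := integral_nonneg fun x => sq_nonneg _
  rw [integral_add (aux_integrable _ (by fun_prop)) (aux_integrable _ (by fun_prop)),
    integral_const_mul]
  nlinarith

theorem aux_lap_smul (c : ℝ) (u : Pt 2 → ℝ) (hu : ContDiff ℝ 2 u) (x : Pt 2) :
    lap (fun x => c * u x) x = c * lap u x := by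
  have hu1 : ContDiff ℝ 1 u := hu.of_le one_le_two
  have e : ∀ i (v : Pt 2 → ℝ), ContDiff ℝ 1 v → pd i (fun x => c * v x) = fun x => c * pd i v x := by
    intro i v hv
    ext x
    unfold pd
    rw [fderiv_const_mul (hv.differentiable one_ne_zero).differentiableAt]
    simp
  simp only [lap, pd2, e _ u hu1, e _ _ (aux_pd1 u hu _), Finset.mul_sum]

theorem aux_lap_add (c : ℝ) (u : Pt 2 → ℝ) (x : Pt 2) :
    lap (fun x => u x + c) x = lap u x := by
  have e : ∀ i (v : Pt 2 → ℝ), pd i (fun x => v x + c) = pd i v := by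
    intro i v
    ext x
    simp only [pd, fderiv_add_const]
  simp only [lap, pd2, e]

theorem aux_vol : (volume : Measure (Pt 2)).real (cube 2) = 1 := by
  simp [cube, Measure.real, Real.volume_Icc_pi]

theorem aux_cube_root (T : ℝ) (hT : T ≠ 0) : ∃ s : ℝ, s ^ 3 * T = 1 := by
  have key : ∀ r : ℝ, 0 ≤ r → ∃ s : ℝ, s^3 = r := fun r hr =>
    ⟨r ^ (((3:ℕ):ℝ)⁻¹), Real.rpow_inv_natCast_pow hr (by norm_num)⟩
  rcases le_total 0 T⁻¹ with h | h
  · obtain ⟨s, hs⟩ := key _ h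
    exact ⟨s, by rw [hs, inv_mul_cancel₀ hT]⟩
  · obtain ⟨s, hs⟩ := key (-T⁻¹) (by linarith)
    refine ⟨-s, ?_⟩
    have : (-s)^3 = T⁻¹ := by linarith [show (-s)^3 = -(s^3) by ring]
    rw [this, inv_mul_cancel₀ hT]

theorem aux_main (a m : ℝ) (h1 : 3*m^2 + (1 - 4*π^2)^2 ≥ a)
    (h2 : PN 2 1 (3*m^2 - a) ≥ 2*m^2) (u : Pt 2 → ℝ) (hu : ContDiff ℝ 2 u)
    (hp : ZPeriodic u) (h0 : ∫ x in cube 2, u x = 0) :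
    2 * m^2 * (∫ x in cube 2, (u x)^3)^2 ≤
      (∫ x in cube 2, ((1 * u x + lap u x)^2 + (3*m^2 - a) * (u x)^2)) *
        (∫ x in cube 2, (u x)^4) := by
  have hQ := aux_Q a m h1 u hu hp h0
  have hR : 0 ≤ ∫ x in cube 2, (u x)^4 := integral_nonneg fun x => by positivity
  by_cases hT : ∫ x in cube 2, (u x)^3 = 0
  · rw [hT]
    have := mul_nonneg hQ hR
    simpa using this
  obtain ⟨s, hs⟩ := aux_cube_root _ hT
  have hadm : AdmissibleP (fun x => s * u x) := by
    refine ⟨contDiff_const.mul hu, fun x i => by beta_reduce; rw [hp x i], ?_, ?_⟩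
    · simp only [mul_pow]
      rw [integral_const_mul, hs]
    · rw [integral_const_mul, h0, mul_zero]
  have hle : PN 2 1 (3*m^2 - a) ≤ Penergy 1 (3*m^2 - a) (fun x => s * u x) := by
    apply csInf_le
    · refine ⟨0, ?_⟩
      rintro p ⟨v, ⟨hv, hvp, -, hv0⟩, rfl⟩
      exact mul_nonneg (aux_Q a m h1 v hv hvp hv0) (integral_nonneg fun x => by positivity)
    · exact ⟨_, hadm, rfl⟩
  have e : Penergy 1 (3*m^2 - a) (fun x => s * u x) = s^6 *
      ((∫ x in cube 2, ((1 * u x + lap u x)^2 + (3*m^2 - a) * (u x)^2)) *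
        (∫ x in cube 2, (u x)^4)) := by
    unfold Penergy
    simp only [aux_lap_smul s u hu, mul_pow]
    have : ∀ x, (1 * (s * u x) + s * lap u x)^2 + (3*m^2 - a) * (s^2 * (u x)^2)
        = s^2 * ((1 * u x + lap u x)^2 + (3*m^2 - a) * (u x)^2) := fun x => by ring
    simp only [this]
    rw [integral_const_mul, integral_const_mul]
    ring
  rw [e] at hle
  set T := ∫ x in cube 2, (u x)^3
  have h3 := mul_le_mul_of_nonneg_left (h2.le.trans hle) (sq_nonneg T)
  have h4 : T^2 * s^6 = 1 := by
    have : T^2 * s^6 = (s^3 * T)^2 := by ring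
    rw [this, hs, one_pow]
  rw [← mul_assoc (T^2) (s^6), h4, one_mul] at h3
  linarith

theorem aux_alg (m Q T R : ℝ) (hQ : 0 ≤ Q) (hR : 0 ≤ R) (h : 2 * m^2 * T^2 ≤ Q * R) :
    0 ≤ 1/2 * Q + m * T + 1/4 * R := by
  have h1 : (m * T)^2 ≤ (1/2 * Q + 1/4 * R)^2 := by nlinarith [sq_nonneg (1/2 * Q - 1/4 * R)]
  have h2 := abs_le_of_sq_le_sq h1 (by positivity)
  linarith [(abs_le.1 h2).1]

/-- PFC order–disorder transition (Remark 3.4 / Theorem 1.3.2 specialized):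
for W(φ) = ¼(φ²-a)², α = 1, N = 2, if 3m² + (1-4π²)² ≥ a and P₂ ≥ 2m², then
the uniform state m is a global minimizer of 𝓕 over H²_m(𝕋²). -/
theorem pfc_order_disorder (a m : ℝ) (ha : 0 < a)
    (h1 : 3*m^2 + (1 - 4*π^2)^2 ≥ a)
    (h2 : PN 2 1 (3*m^2 - a) ≥ 2*m^2) :
    ∀ φ : Pt 2 → ℝ, MemH2m m φ →
      Fen 1 (fun t => (1/4)*(t^2 - a)^2) φ ≥
        Fen 1 (fun t => (1/4)*(t^2 - a)^2) (fun _ : Pt 2 => m) := by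
  intro φ ⟨hφ, hper, hm⟩
  set u : Pt 2 → ℝ := fun x => φ x - m with hu_def
  have hu : ContDiff ℝ 2 u := hφ.sub contDiff_const
  have hp : ZPeriodic u := fun x i => by simp only [hu_def, hper x i]
  have c0 := hφ.continuous
  have c1 : Continuous u := hu.continuous
  have c2 : Continuous (lap u) := aux_lap_cont u hu
  have h0 : ∫ x in cube 2, u x = 0 := by
    rw [hu_def, integral_sub (aux_integrable _ c0) (aux_integrable _ continuous_const), hm]
    simp [aux_vol]
  have hφu : φ = fun x => u x + m := by ext x; simp [hu_def]
  have hQ := aux_Q a m h1 u hu hp h0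
  have hR : 0 ≤ ∫ x in cube 2, (u x)^4 := integral_nonneg fun x => by positivity
  have A := aux_alg m _ _ _ hQ hR (aux_main a m h1 h2 u hu hp h0)
  have L := aux_int_lap u hu hp
  have lc : ∀ x, lap (fun _ : Pt 2 => m) x = 0 := by
    intro x
    have := aux_lap_add m (fun _ => 0) x
    simp only [zero_add] at this
    rw [this]
    have := aux_lap_smul 0 (fun _ => 0) contDiff_const x
    simpa using this
  have E : Fen 1 (fun t => (1/4)*(t^2 - a)^2) φ
      = Fen 1 (fun t => (1/4)*(t^2 - a)^2) (fun _ : Pt 2 => m)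
        + (1/2 * (∫ x in cube 2, ((1 * u x + lap u x)^2 + (3*m^2 - a) * (u x)^2))
          + m * (∫ x in cube 2, (u x)^3) + 1/4 * (∫ x in cube 2, (u x)^4))
        + ((m + m * (m^2 - a)) * (∫ x in cube 2, u x) + m * ∫ x in cube 2, lap u x) := by
    have hl : ∀ x, lap φ x = lap u x := by
      intro x; rw [hφu]; exact aux_lap_add m u x
    unfold Fen
    simp only [hl, lc]
    rw [← integral_const_mul, ← integral_const_mul, ← integral_const_mul, ← integral_const_mul,
      ← integral_const_mul, ← integral_add, ← integral_add, ← integral_add, ← integral_add,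
      ← integral_add]
    · congr 1; ext x
      have : φ x = u x + m := by simp [hu_def]
      rw [this]; ring
    all_goals exact aux_integrable _ (by fun_prop)
  rw [E, h0, L]
  linarith

end
end
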